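/- arXiv:2106.14479 — 2 statements merged into one kernel-verified Lean document; each statement's English description precedes it below -/
import Mathlib

section
/- With the expectation over independent uniform sample indices written as a finite average, one has (1/∏_{i=1}^{n} m_i) · ∑_{s_1=1}^{m_1} ⋯ ∑_{s_n=1}^{m_n} ‖ (1/n)·∑_{i=1}^{n} ( v_i(s_i) − ∇f_i(x̄) ) ‖² ≤ (1/n)·∑_{i=1}^{n} ( 6L²‖x_i − x̄‖² + 4L²‖τ_i − x̄‖² ). -/
/-- Averaging over a product of finite types a function of a single coordinate. -/
theorem inv_prod_card_mul_sum_comp_eval {ι : Type*} [Fintype ι] [DecidableEq ι] {κ : ι → Type*}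
    [∀ i, Fintype (κ i)] [∀ i, Nonempty (κ i)] (i : ι) (h : κ i → ℝ) :
    (∏ k, (Fintype.card (κ k) : ℝ))⁻¹ * ∑ s : (k : ι) → κ k, h (s i)
      = (Fintype.card (κ i) : ℝ)⁻¹ * ∑ j, h j := by
  let g : (k : ι) → κ k → ℝ :=
    Function.update (fun k _ => (Fintype.card (κ k) : ℝ)⁻¹ * 1)
      i fun j => (Fintype.card (κ i) : ℝ)⁻¹ * h j
  have hcard (k : ι) : (Fintype.card (κ k) : ℝ) ≠ 0 := by simp
  have hprod (s : (k : ι) → κ k) :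
      ∏ k, g k (s k) = (∏ k, (Fintype.card (κ k) : ℝ))⁻¹ * h (s i) := by
    rw [← Finset.prod_inv_distrib, ← Finset.mul_prod_erase _ _ (Finset.mem_univ i),
      ← Finset.mul_prod_erase _ (fun k => (Fintype.card (κ k) : ℝ)⁻¹) (Finset.mem_univ i),
      Finset.prod_congr rfl fun k hk => show g k (s k) = (Fintype.card (κ k) : ℝ)⁻¹ by
        simp [g, Function.update_of_ne (Finset.ne_of_mem_erase hk)]]
    simp only [g, Function.update_self]
    ring
  have hsum : ∏ k, ∑ j, g k j = (Fintype.card (κ i) : ℝ)⁻¹ * ∑ j, h j := by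
    rw [← Finset.mul_prod_erase _ _ (Finset.mem_univ i), Finset.prod_eq_one, mul_one]
    · simp only [g, Function.update_self, Finset.mul_sum]
    · intro k hk
      simp [g, Function.update_of_ne (Finset.ne_of_mem_erase hk), hcard k]
  rw [← hsum, Finset.prod_univ_sum, Fintype.piFinset_univ, Finset.mul_sum]
  exact Finset.sum_congr rfl fun s _ => (hprod s).symm

section

variable {ι E : Type*} [Fintype ι] [NormedAddCommGroup E] [InnerProductSpace ℝ E]

theorem norm_average_sq_le (a : ι → E) :
    ‖(Fintype.card ι : ℝ)⁻¹ • ∑ i, a i‖ ^ 2 ≤ (Fintype.card ι : ℝ)⁻¹ * ∑ i, ‖a i‖ ^ 2 := by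
  rcases isEmpty_or_nonempty ι with _ | _
  · simp
  have hpos : (0 : ℝ) < Fintype.card ι := by exact_mod_cast Fintype.card_pos
  have h : ‖∑ i, a i‖ ^ 2 ≤ Fintype.card ι * ∑ i, ‖a i‖ ^ 2 :=
    (pow_le_pow_left₀ (norm_nonneg _) (norm_sum_le _ _) 2).trans
      (by simpa using sq_sum_le_card_mul_sum_sq (s := Finset.univ) (f := fun i => ‖a i‖))
  rw [norm_smul, mul_pow, norm_inv, Real.norm_natCast]
  calc _ ≤ ((Fintype.card ι : ℝ)⁻¹) ^ 2 * (Fintype.card ι * ∑ i, ‖a i‖ ^ 2) := by gcongr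
    _ = _ := by field_simp

theorem sum_norm_sub_average_sq_le (a : ι → E) :
    ∑ i, ‖a i - (Fintype.card ι : ℝ)⁻¹ • ∑ k, a k‖ ^ 2 ≤ ∑ i, ‖a i‖ ^ 2 := by
  rcases isEmpty_or_nonempty ι with _ | _
  · simp
  set μ := (Fintype.card ι : ℝ)⁻¹ • ∑ k, a k with hμ
  have hsum : ∑ k, a k = (Fintype.card ι : ℝ) • μ := by
    rw [hμ, smul_inv_smul₀ (by simp)]
  have hinner : ∑ i, inner ℝ (a i) μ = Fintype.card ι * ‖μ‖ ^ 2 := by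
    rw [← sum_inner, hsum, real_inner_smul_left, real_inner_self_eq_norm_sq]
  simp only [norm_sub_sq_real, Finset.sum_add_distrib, Finset.sum_sub_distrib, ← Finset.mul_sum,
    hinner, Finset.sum_const, Finset.card_univ, nsmul_eq_mul]
  have : 0 ≤ Fintype.card ι * ‖μ‖ ^ 2 := by positivity
  linarith

theorem norm_add_sq_le_two_mul (a b : E) : ‖a + b‖ ^ 2 ≤ 2 * ‖a‖ ^ 2 + 2 * ‖b‖ ^ 2 := by
  have := parallelogram_law_with_norm ℝ a b
  nlinarith [sq_nonneg ‖a - b‖]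

theorem gradient_const_mul_sum [CompleteSpace E] (c : ℝ) {f : ι → E → ℝ}
    (hf : ∀ i, Differentiable ℝ (f i)) (x : E) :
    gradient (fun y => c * ∑ i, f i y) x = c • ∑ i, gradient (f i) x := by
  simp only [gradient]
  rw [fderiv_const_mul (DifferentiableAt.fun_sum fun i _ => hf i x),
    fderiv_fun_sum fun i _ => hf i x]
  simp

/-- The mean squared error of a variance-reduced gradient estimator evaluated at `x`, with
snapshot point `τ`, as an approximation of the full gradient at `y`. -/
theorem average_norm_vr_estimator_sub_sq_le {g : ι → E → E} {L : ℝ}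
    (hg : ∀ j x y, ‖g j x - g j y‖ ≤ L * ‖x - y‖) {G : E → E}
    (hG : ∀ x, G x = (Fintype.card ι : ℝ)⁻¹ • ∑ j, g j x) (x τ y : E) :
    (Fintype.card ι : ℝ)⁻¹ * ∑ j, ‖g j x - g j τ + G τ - G y‖ ^ 2
      ≤ 2 * L ^ 2 * ‖x - y‖ ^ 2 + 2 * L ^ 2 * ‖τ - y‖ ^ 2 := by
  rcases isEmpty_or_nonempty ι with _ | _
  · simp only [Fintype.card_eq_zero, Nat.cast_zero, inv_zero, zero_mul]
    positivity
  have hpos : (0 : ℝ) < Fintype.card ι := by exact_mod_cast Fintype.card_pos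
  have hg_sq (j : ι) (u v : E) : ‖g j u - g j v‖ ^ 2 ≤ L ^ 2 * ‖u - v‖ ^ 2 := by
    rw [← mul_pow]
    exact pow_le_pow_left₀ (norm_nonneg _) (hg j u v) 2
  have hGsub : G y - G τ = (Fintype.card ι : ℝ)⁻¹ • ∑ j, (g j y - g j τ) := by
    rw [hG, hG, Finset.sum_sub_distrib, smul_sub]
  have hcentered : ∑ j, ‖g j y - g j τ - (G y - G τ)‖ ^ 2
      ≤ Fintype.card ι * (L ^ 2 * ‖τ - y‖ ^ 2) := by
    rw [hGsub, norm_sub_rev τ y]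
    refine (sum_norm_sub_average_sq_le _).trans ?_
    simpa using Finset.sum_le_sum fun j (_ : j ∈ Finset.univ) => hg_sq j y τ
  have hlocal : ∑ j, ‖g j x - g j y‖ ^ 2 ≤ Fintype.card ι * (L ^ 2 * ‖x - y‖ ^ 2) := by
    simpa using Finset.sum_le_sum fun j (_ : j ∈ Finset.univ) => hg_sq j x y
  have hsplit : ∑ j, ‖g j x - g j τ + G τ - G y‖ ^ 2
      ≤ 2 * ∑ j, ‖g j x - g j y‖ ^ 2 + 2 * ∑ j, ‖g j y - g j τ - (G y - G τ)‖ ^ 2 := by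
    rw [Finset.mul_sum, Finset.mul_sum, ← Finset.sum_add_distrib]
    refine Finset.sum_le_sum fun j _ => ?_
    have hdecomp : g j x - g j τ + G τ - G y
        = (g j x - g j y) + (g j y - g j τ - (G y - G τ)) := by abel
    rw [hdecomp]
    exact norm_add_sq_le_two_mul _ _
  rw [inv_mul_le_iff₀ hpos]
  linarith

end



theorem vr_estimator_average_deviation_bound
    (d n : ℕ) (hd : 1 ≤ d) (hn : 1 ≤ n) (L : ℝ) (hL : 0 < L)
    (m : Fin n → ℕ) (hm : ∀ i, 1 ≤ m i)
    (F : (i : Fin n) → Fin (m i) → EuclideanSpace ℝ (Fin d) → ℝ)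
    (hFdiff : ∀ i j, Differentiable ℝ (F i j))
    (hFlip : ∀ i j x' y', ‖gradient (F i j) x' - gradient (F i j) y'‖ ≤ L * ‖x' - y'‖)
    (fi : Fin n → EuclideanSpace ℝ (Fin d) → ℝ)
    (hfi : ∀ i x', fi i x' = (m i : ℝ)⁻¹ * ∑ j, F i j x')
    (f : EuclideanSpace ℝ (Fin d) → ℝ)
    (hf : ∀ x', f x' = (n : ℝ)⁻¹ * ∑ i, fi i x')
    (x τ : Fin n → EuclideanSpace ℝ (Fin d))
    (xbar : EuclideanSpace ℝ (Fin d)) (hxbar : xbar = (n : ℝ)⁻¹ • ∑ i, x i)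
    (vv : (i : Fin n) → Fin (m i) → EuclideanSpace ℝ (Fin d))
    (hvv : ∀ i j, vv i j
        = gradient (F i j) (x i) - gradient (F i j) (τ i) + gradient (fi i) (τ i)) :
    (∏ i, (m i : ℝ))⁻¹ * ∑ sf : (i : Fin n) → Fin (m i),
        ‖(n : ℝ)⁻¹ • ∑ i, (vv i (sf i) - gradient (fi i) xbar)‖ ^ 2
      ≤ (n : ℝ)⁻¹ * ∑ i,
          (6 * L ^ 2 * ‖x i - xbar‖ ^ 2 + 4 * L ^ 2 * ‖τ i - xbar‖ ^ 2) := by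
  have (i : Fin n) : Nonempty (Fin (m i)) := ⟨⟨0, hm i⟩⟩
  have hgrad (i : Fin n) (y : EuclideanSpace ℝ (Fin d)) :
      gradient (fi i) y = (Fintype.card (Fin (m i)) : ℝ)⁻¹ • ∑ j, gradient (F i j) y := by
    rw [funext (hfi i), gradient_const_mul_sum _ (hFdiff i), Fintype.card_fin]
  calc (∏ i, (m i : ℝ))⁻¹ * ∑ sf : (i : Fin n) → Fin (m i),
        ‖(n : ℝ)⁻¹ • ∑ i, (vv i (sf i) - gradient (fi i) xbar)‖ ^ 2
      ≤ (∏ i, (m i : ℝ))⁻¹ * ∑ sf : (i : Fin n) → Fin (m i),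
        (n : ℝ)⁻¹ * ∑ i, ‖vv i (sf i) - gradient (fi i) xbar‖ ^ 2 := by
        gcongr with sf
        simpa using norm_average_sq_le fun i => vv i (sf i) - gradient (fi i) xbar
    _ = (n : ℝ)⁻¹ * ∑ i, (∏ k, (m k : ℝ))⁻¹ * ∑ sf : (k : Fin n) → Fin (m k),
        ‖vv i (sf i) - gradient (fi i) xbar‖ ^ 2 := by
        rw [← Finset.mul_sum, Finset.sum_comm, ← Finset.mul_sum]
        ring
    _ = (n : ℝ)⁻¹ * ∑ i, (m i : ℝ)⁻¹ * ∑ j, ‖vv i j - gradient (fi i) xbar‖ ^ 2 := by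
        congr 1
        refine Finset.sum_congr rfl fun i _ => ?_
        simpa using inv_prod_card_mul_sum_comp_eval (κ := fun k => Fin (m k)) i
          fun j => ‖vv i j - gradient (fi i) xbar‖ ^ 2
    _ ≤ (n : ℝ)⁻¹ * ∑ i,
          (6 * L ^ 2 * ‖x i - xbar‖ ^ 2 + 4 * L ^ 2 * ‖τ i - xbar‖ ^ 2) := by
        gcongr with i
        have h := average_norm_vr_estimator_sub_sq_le (hFlip i) (hgrad i) (x i) (τ i) xbar
        rw [Fintype.card_fin] at h
        simp only [hvv]
        refine h.trans ?_
        gcongr <;> norm_num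
end

section
/- (Robbins–Siegmund) Let (Ω, F, ℙ) be a probability space with a filtration (F_t)_{t≥1}, and let U^t, ξ^t, ζ^t (t ≥ 1) be nonnegative, integrable, F_t-measurable random variables such that E[U^{t+1} | F_t] ≤ U^t + ξ^t − ζ^t almost surely for every t ≥ 1. Then, almost surely on the event { ∑_{t=1}^{∞} ξ^t < ∞ }, the sequence (U^t) converges (to a finite limit) and ∑_{t=1}^{∞} ζ^t < ∞. -/
open MeasureTheory Filter

theorem robbins_siegmund_of_sum_le {Ω : Type*} {m0 : MeasurableSpace Ω} {μ : Measure Ω}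
    [IsFiniteMeasure μ] {ℱ : Filtration ℕ m0} {U ξ ζ : ℕ → Ω → ℝ} {a : ℝ}
    (hUnn : ∀ t ω, 0 ≤ U t ω) (hξnn : ∀ t ω, 0 ≤ ξ t ω) (hζnn : ∀ t ω, 0 ≤ ζ t ω)
    (hUint : ∀ t, Integrable (U t) μ) (hξint : ∀ t, Integrable (ξ t) μ)
    (hζint : ∀ t, Integrable (ζ t) μ)
    (hUmeas : ∀ t, StronglyMeasurable[ℱ t] (U t))
    (hξmeas : ∀ t, StronglyMeasurable[ℱ t] (ξ t))
    (hζmeas : ∀ t, StronglyMeasurable[ℱ t] (ζ t))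
    (hrec : ∀ t, ∀ᵐ ω ∂μ, (μ[U (t + 1)|ℱ t]) ω ≤ U t ω + ξ t ω - ζ t ω)
    (hsum : ∀ n ω, ∑ k ∈ Finset.range n, ξ k ω ≤ a) :
    ∀ᵐ ω ∂μ, (∃ c : ℝ, Tendsto (fun t => U t ω) atTop (nhds c)) ∧
      Summable (fun t => ζ t ω) := by
  let D : ℕ → Ω → ℝ := fun n => ∑ k ∈ Finset.range n, (ζ k - ξ k) + fun _ => a
  let W : ℕ → Ω → ℝ := fun n => U n + D n
  have hW_apply (n ω) : W n ω =
      U n ω + (∑ k ∈ Finset.range n, ζ k ω - ∑ k ∈ Finset.range n, ξ k ω + a) := by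
    simp [W, D, Finset.sum_apply]
  have hD_int (n) : Integrable (D n) μ :=
    (integrable_finsetSum' _ fun k _ => (hζint k).sub (hξint k)).add (integrable_const a)
  have hW_int (n) : Integrable (W n) μ := (hUint n).add (hD_int n)
  have hD_meas (m n) (hmn : n ≤ m + 1) : StronglyMeasurable[ℱ m] (D n) := by
    refine StronglyMeasurable.add (Finset.stronglyMeasurable_sum _ fun k hk => ?_)
      stronglyMeasurable_const
    have hkm : k ≤ m := by have := Finset.mem_range.1 hk; omega
    exact ((hζmeas k).mono (ℱ.mono hkm)).sub ((hξmeas k).mono (ℱ.mono hkm))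
  have hW_super : Supermartingale W ℱ μ := by
    refine supermartingale_nat (fun n => (hUmeas n).add (hD_meas n n n.le_succ)) hW_int fun n => ?_
    have hadd := condExp_add (hUint (n + 1)) (hD_int (n + 1)) (ℱ n)
    rw [condExp_of_stronglyMeasurable (ℱ.le n) (hD_meas n (n + 1) le_rfl) (hD_int _)] at hadd
    filter_upwards [hadd, hrec n] with ω h₁ h₂
    have h₃ : (μ[W (n + 1)|ℱ n]) ω = (μ[U (n + 1)|ℱ n]) ω + D (n + 1) ω := h₁
    have h₄ : D (n + 1) ω = D n ω + (ζ n ω - ξ n ω) := by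
      simp only [D, Finset.sum_range_succ, Pi.add_apply, Pi.sub_apply]
      ring
    have h₅ : W n ω = U n ω + D n ω := rfl
    linarith
  have hW_lower (n ω) : ∑ k ∈ Finset.range n, ζ k ω ≤ W n ω := by
    linarith [hW_apply n ω, hUnn n ω, hsum n ω]
  have hW_nn (n ω) : 0 ≤ W n ω :=
    (Finset.sum_nonneg fun k _ => hζnn k ω).trans (hW_lower n ω)
  have hbdd (n) : eLpNorm ((-W) n) 1 μ ≤ ((∫ ω, W 0 ω ∂μ).toNNReal : ENNReal) := by
    rw [Pi.neg_apply, eLpNorm_neg, eLpNorm_one_eq_lintegral_enorm,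
      ← ofReal_integral_norm_eq_lintegral_enorm (hW_int n)]
    refine ENNReal.ofReal_le_ofReal ?_
    simp_rw [Real.norm_of_nonneg (hW_nn n _)]
    simpa using hW_super.setIntegral_le (Nat.zero_le n) MeasurableSet.univ
  filter_upwards [hW_super.neg.exists_ae_tendsto_of_bdd hbdd] with ω ⟨c, hc⟩
  have hW_lim : Tendsto (fun n => W n ω) atTop (nhds (-c)) := by simpa using hc.neg
  obtain ⟨b, hb⟩ := hW_lim.bddAbove_range
  have hζ : Summable fun t => ζ t ω :=
    summable_of_sum_range_le (fun t => hζnn t ω) fun n =>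
      (hW_lower n ω).trans (hb (Set.mem_range_self n))
  have hξ : Summable fun t => ξ t ω :=
    summable_of_sum_range_le (fun t => hξnn t ω) fun n => hsum n ω
  refine ⟨⟨_, (hW_lim.sub ((hζ.hasSum.tendsto_sum_nat.sub
    hξ.hasSum.tendsto_sum_nat).add_const a)).congr fun n => ?_⟩, hζ⟩
  rw [hW_apply]
  ring

theorem robbins_siegmund_of_forall {Ω : Type*} {m0 : MeasurableSpace Ω} {μ : Measure Ω}
    [IsFiniteMeasure μ] {ℱ : Filtration ℕ m0} {U ξ ζ : ℕ → Ω → ℝ}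
    (hUnn : ∀ t ω, 0 ≤ U t ω) (hξnn : ∀ t ω, 0 ≤ ξ t ω) (hζnn : ∀ t ω, 0 ≤ ζ t ω)
    (hUint : ∀ t, Integrable (U t) μ) (hξint : ∀ t, Integrable (ξ t) μ)
    (hζint : ∀ t, Integrable (ζ t) μ)
    (hUmeas : ∀ t, StronglyMeasurable[ℱ t] (U t))
    (hξmeas : ∀ t, StronglyMeasurable[ℱ t] (ξ t))
    (hζmeas : ∀ t, StronglyMeasurable[ℱ t] (ζ t))
    (hrec : ∀ t, ∀ᵐ ω ∂μ, (μ[U (t + 1)|ℱ t]) ω ≤ U t ω + ξ t ω - ζ t ω) :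
    ∀ᵐ ω ∂μ, (Summable fun t => ξ t ω) →
      (∃ c : ℝ, Tendsto (fun t => U t ω) atTop (nhds c)) ∧ Summable (fun t => ζ t ω) := by
  let S : ℕ → Ω → ℝ := fun n => ∑ k ∈ Finset.range (n + 1), ξ k
  have hS_apply (n ω) : S n ω = ∑ k ∈ Finset.range (n + 1), ξ k ω := by
    simp [S, Finset.sum_apply]
  let E : ℕ → ℕ → Set Ω := fun a n => {ω | S n ω ≤ a}
  have hE_meas (a n) : MeasurableSet[ℱ n] (E a n) := by
    have hS : StronglyMeasurable[ℱ n] (S n) := Finset.stronglyMeasurable_sum _ fun k hk =>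
      (hξmeas k).mono (ℱ.mono (Nat.lt_succ_iff.1 (Finset.mem_range.1 hk)))
    exact hS.measurable measurableSet_Iic
  have hE_anti (a n) : E a (n + 1) ⊆ E a n := fun ω hω => by
    have h : S (n + 1) ω ≤ a := hω
    rw [hS_apply, Finset.sum_range_succ, ← hS_apply] at h
    exact (le_add_of_nonneg_right (hξnn _ _)).trans h
  have key (a : ℕ) := robbins_siegmund_of_sum_le (μ := μ) (ℱ := ℱ) (a := a)
    (U := fun n => (E a n).indicator (U n)) (ξ := fun n => (E a n).indicator (ξ n))
    (ζ := fun n => (E a n).indicator (ζ n))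
    (fun t ω => Set.indicator_nonneg (fun ω _ => hUnn t ω) ω)
    (fun t ω => Set.indicator_nonneg (fun ω _ => hξnn t ω) ω)
    (fun t ω => Set.indicator_nonneg (fun ω _ => hζnn t ω) ω)
    (fun t => (hUint t).indicator (ℱ.le t _ (hE_meas a t)))
    (fun t => (hξint t).indicator (ℱ.le t _ (hE_meas a t)))
    (fun t => (hζint t).indicator (ℱ.le t _ (hE_meas a t)))
    (fun t => (hUmeas t).indicator (hE_meas a t))
    (fun t => (hξmeas t).indicator (hE_meas a t))
    (fun t => (hζmeas t).indicator (hE_meas a t))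
    (fun t => by
      have hmono : μ[(E a (t + 1)).indicator (U (t + 1))|ℱ t] ≤ᵐ[μ]
          μ[(E a t).indicator (U (t + 1))|ℱ t] :=
        condExp_mono ((hUint _).indicator (ℱ.le _ _ (hE_meas a _)))
          ((hUint _).indicator (ℱ.le _ _ (hE_meas a _)))
          (ae_of_all _ (Set.indicator_le_indicator_of_subset (hE_anti a t) (hUnn (t + 1))))
      filter_upwards [hmono, condExp_indicator (hUint (t + 1)) (hE_meas a t), hrec t]
        with ω h₁ h₂ h₃
      refine h₁.trans (h₂.trans_le ?_)
      by_cases hω : ω ∈ E a t <;> simp [hω, h₃])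
    (fun n ω => by
      induction n with
      | zero => simp
      | succ n ih =>
        by_cases hω : ω ∈ E a n
        · refine le_trans (Finset.sum_le_sum fun k _ =>
            Set.indicator_le_self' (fun ω _ => hξnn k ω) ω) ?_
          exact (hS_apply n ω).symm.trans_le hω
        · simpa [Finset.sum_range_succ, hω] using ih)
  filter_upwards [ae_all_iff.2 key] with ω hω hξ
  obtain ⟨a, ha⟩ := exists_nat_ge (∑' t, ξ t ω)
  have hmem (n) : ω ∈ E a n := by
    refine le_trans ?_ ha
    rw [hS_apply]
    exact hξ.sum_le_tsum _ fun k _ => hξnn k ω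
  simpa [hmem] using hω a

theorem robbins_siegmund
    (Ω : Type*) (m0 : MeasurableSpace Ω) (μ : Measure Ω) [IsProbabilityMeasure μ]
    (ℱ : Filtration ℕ m0)
    (U ξ ζ : ℕ → Ω → ℝ)
    (hUnn : ∀ t ω, 0 ≤ U t ω) (hξnn : ∀ t ω, 0 ≤ ξ t ω) (hζnn : ∀ t ω, 0 ≤ ζ t ω)
    (hUint : ∀ t, Integrable (U t) μ)
    (hξint : ∀ t, Integrable (ξ t) μ)
    (hζint : ∀ t, Integrable (ζ t) μ)
    (hUmeas : ∀ t, StronglyMeasurable[ℱ t] (U t))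
    (hξmeas : ∀ t, StronglyMeasurable[ℱ t] (ξ t))
    (hζmeas : ∀ t, StronglyMeasurable[ℱ t] (ζ t))
    (hrec : ∀ t, 1 ≤ t → ∀ᵐ ω ∂μ, (μ[U (t + 1)|ℱ t]) ω ≤ U t ω + ξ t ω - ζ t ω) :
    ∀ᵐ ω ∂μ, (Summable fun t => ξ t ω) →
      (∃ c : ℝ, Tendsto (fun t => U t ω) atTop (nhds c))
        ∧ Summable (fun t => ζ t ω) := by
  let 𝒢 : Filtration ℕ m0 :=
    ⟨fun t => ℱ (t + 1), fun _ _ h => ℱ.mono (Nat.succ_le_succ h), fun t => ℱ.le (t + 1)⟩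
  have key := robbins_siegmund_of_forall (μ := μ) (ℱ := 𝒢)
    (U := fun t => U (t + 1)) (ξ := fun t => ξ (t + 1)) (ζ := fun t => ζ (t + 1))
    (fun _ => hUnn _) (fun _ => hξnn _) (fun _ => hζnn _)
    (fun _ => hUint _) (fun _ => hξint _) (fun _ => hζint _)
    (fun _ => hUmeas _) (fun _ => hξmeas _) (fun _ => hζmeas _)
    (fun t => hrec (t + 1) t.succ_pos)
  filter_upwards [key] with ω hω hξ
  obtain ⟨⟨c, hc⟩, hζ⟩ := hω ((summable_nat_add_iff 1).2 hξ)
  exact ⟨⟨c, (tendsto_add_atTop_iff_nat 1).1 hc⟩, (summable_nat_add_iff 1).1 hζ⟩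
end
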